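/- arXiv:1701.02819 — 2 statements merged into one kernel-verified Lean document; each statement's English description precedes it below -/
import Mathlib

section
/- Let V = {1,…,n} be a finite set, let 𝓗 be a finite hypergraph on V, and for each i ∈ V let Γ_i be an impartial game. Then for every position x = (x_1,…,x_n) of the 𝓗-combination Γ_𝓗 one has 𝓣_{Γ_𝓗}(x) = 𝓣_𝓗(𝓣_{Γ_1}(x_1),…,𝓣_{Γ_n}(x_n)), where 𝓣_𝓗 denotes the Tetris function of the game NIM_𝓗. -/
/-- The minimum excludant of a set of natural numbers. -/
noncomputable def mex (S : Set ℕ) : ℕ := sInf {n : ℕ | n ∉ S}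

open Classical in
/-- The Sprague–Grundy function of the impartial game with move relation `move`
(meaningful when every play is finite, i.e. the reversed move relation is
well-founded): it satisfies `sgFun move x = mex {sgFun move y | move x y}`. -/
noncomputable def sgFun {X : Type*} (move : X → X → Prop) : X → ℕ :=
  if hwf : WellFounded (fun y x => move x y) then
    hwf.fix (fun x ih => mex {v : ℕ | ∃ (y : X) (h : move x y), ih y h = v})
  else fun _ => 0

open Classical in
/-- The Tetris function: the length of a longest play starting at `x`
(meaningful when every play is finite and the game is finitely branching):
it satisfies `tetrisFun move x = sup {tetrisFun move y + 1 | move x y}`. -/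
noncomputable def tetrisFun {X : Type*} (move : X → X → Prop) : X → ℕ :=
  if hwf : WellFounded (fun y x => move x y) then
    hwf.fix (fun x ih => sSup {v : ℕ | ∃ (y : X) (h : move x y), v = ih y h + 1})
  else fun _ => 0

/-- A game is SG decreasing if every move strictly decreases the SG value. -/
def SGDecreasing {X : Type*} (move : X → X → Prop) : Prop :=
  ∀ x y, move x y → sgFun move y < sgFun move x

/-- The move relation of the game `NIM_𝓗` on positions `ℕ^V`. -/
def nimMove {V : Type*} (𝓗 : Set (Finset V)) (x x' : V → ℕ) : Prop :=
  ∃ H ∈ 𝓗, (∀ i ∈ H, x' i < x i) ∧ ∀ i ∉ H, x' i = x i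

/-- A hypergraph is Tetris if `NIM_𝓗` is SG decreasing. -/
def IsTetrisHypergraph {V : Type*} (𝓗 : Set (Finset V)) : Prop :=
  SGDecreasing (nimMove 𝓗)

/-- The move relation of the `𝓗`-combination of the games `move i`. -/
def combMove {V : Type*} {X : V → Type*} (𝓗 : Set (Finset V))
    (move : ∀ i, X i → X i → Prop) (x x' : ∀ i, X i) : Prop :=
  ∃ H ∈ 𝓗, (∀ i ∈ H, move i (x i) (x' i)) ∧ ∀ i ∉ H, x' i = x i

/-- Condition (*): every nonempty induced subhypergraph has a hyperedge
intersecting all its hyperedges. -/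
def CondStar {V : Type*} [DecidableEq V] (𝓗 : Set (Finset V)) : Prop :=
  ∀ S : Finset V, (∃ H ∈ 𝓗, H ⊆ S) →
    ∃ H ∈ 𝓗, H ⊆ S ∧ ∀ H' ∈ 𝓗, H' ⊆ S → (H ∩ H').Nonempty

/-- There is a play of length `n` starting at `x`. -/
def HasPlay {X : Type*} (move : X → X → Prop) : ℕ → X → Prop
  | 0, _ => True
  | n + 1, x => ∃ y, move x y ∧ HasPlay move n y

theorem tetrisFun_eq {X : Type*} (move : X → X → Prop)
    (hwf : WellFounded (fun y x => move x y)) (x : X) :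
    tetrisFun move x = sSup {v : ℕ | ∃ (y : X) (_ : move x y), v = tetrisFun move y + 1} := by
  have h : tetrisFun move = hwf.fix
      (fun x ih => sSup {v : ℕ | ∃ (y : X) (h : move x y), v = ih y h + 1}) := by
    unfold tetrisFun
    rw [dif_pos hwf]
  rw [h]
  exact hwf.fix_eq _ x

theorem tetris_bdd {X : Type*} (move : X → X → Prop)
    (hfin : ∀ x, {y | move x y}.Finite) (x : X) :
    BddAbove {v : ℕ | ∃ (y : X) (_ : move x y), v = tetrisFun move y + 1} := by
  apply Set.Finite.bddAbove
  refine ((hfin x).image (fun y => tetrisFun move y + 1)).subset ?_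
  rintro v ⟨y, hy, rfl⟩
  exact ⟨y, hy, rfl⟩

theorem tetris_lt {X : Type*} (move : X → X → Prop)
    (hwf : WellFounded (fun y x => move x y))
    (hfin : ∀ x, {y | move x y}.Finite) {x y : X} (h : move x y) :
    tetrisFun move y < tetrisFun move x := by
  rw [tetrisFun_eq move hwf x]
  exact le_csSup (tetris_bdd move hfin x) ⟨y, h, rfl⟩

theorem tetris_exists {X : Type*} (move : X → X → Prop)
    (hwf : WellFounded (fun y x => move x y))
    (hfin : ∀ x, {y | move x y}.Finite) {x : X} {n : ℕ} (h : n < tetrisFun move x) :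
    ∃ y, move x y ∧ n ≤ tetrisFun move y := by
  have hs := tetrisFun_eq move hwf x
  have hne : {v : ℕ | ∃ (y : X) (_ : move x y), v = tetrisFun move y + 1}.Nonempty := by
    by_contra hc
    rw [Set.not_nonempty_iff_eq_empty] at hc
    rw [hc] at hs
    simp at hs
    omega
  obtain ⟨y, hy, he⟩ := Nat.sSup_mem hne (tetris_bdd move hfin x)
  exact ⟨y, hy, by omega⟩

theorem le_tetris_iff {X : Type*} (move : X → X → Prop)
    (hwf : WellFounded (fun y x => move x y))
    (hfin : ∀ x, {y | move x y}.Finite) (n : ℕ) :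
    ∀ x, n ≤ tetrisFun move x ↔ HasPlay move n x := by
  induction n with
  | zero => intro x; simp [HasPlay]
  | succ n ih =>
    intro x
    constructor
    · intro h
      obtain ⟨y, hy, hn⟩ := tetris_exists move hwf hfin (Nat.lt_of_succ_le h)
      exact ⟨y, hy, (ih y).1 hn⟩
    · rintro ⟨y, hy, hp⟩
      have h1 := (ih y).2 hp
      have h2 := tetris_lt move hwf hfin hy
      omega

theorem comb_wf {V : Type*} [Fintype V] {X : V → Type*}
    (𝓗 : Set (Finset V)) (hne : ∀ H ∈ 𝓗, H.Nonempty)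
    (move : ∀ i, X i → X i → Prop) (f : ∀ i, X i → ℕ)
    (hf : ∀ i x y, move i x y → f i y < f i x) :
    WellFounded (fun y x => combMove 𝓗 move x y) := by
  refine Subrelation.wf ?_ (measure (fun x : ∀ i, X i => ∑ i, f i (x i))).wf
  rintro y x ⟨H, hH, h1, h2⟩
  obtain ⟨j, hj⟩ := hne H hH
  change ∑ i, f i (y i) < ∑ i, f i (x i)
  refine Finset.sum_lt_sum (fun i _ => ?_) ⟨j, Finset.mem_univ j, hf j _ _ (h1 j hj)⟩
  by_cases hi : i ∈ H
  · exact (hf i _ _ (h1 i hi)).le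
  · rw [h2 i hi]

theorem comb_fin {V : Type*} [Fintype V] {X : V → Type*}
    (𝓗 : Set (Finset V)) (move : ∀ i, X i → X i → Prop)
    (hfin : ∀ i x, {y | move i x y}.Finite) (x : ∀ i, X i) :
    {y | combMove 𝓗 move x y}.Finite := by
  refine (Set.Finite.pi' (fun i => (hfin i (x i)).insert (x i))).subset ?_
  rintro y ⟨H, hH, h1, h2⟩ i
  by_cases hi : i ∈ H
  · exact Or.inr (h1 i hi)
  · exact Or.inl (h2 i hi)

theorem stmt1 {V : Type*} [Fintype V] {X : V → Type*}
    (𝓗 : Set (Finset V)) (hne : ∀ H ∈ 𝓗, H.Nonempty)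
    (move : ∀ i, X i → X i → Prop)
    (hwf : ∀ i, WellFounded (fun y x => move i x y))
    (hfin : ∀ i x, {y | move i x y}.Finite) :
    ∀ x : ∀ i, X i,
      tetrisFun (combMove 𝓗 move) x
        = tetrisFun (nimMove 𝓗) (fun i => tetrisFun (move i) (x i)) := by
  classical
  have hc := le_tetris_iff (combMove 𝓗 move)
    (comb_wf 𝓗 hne move (fun i => tetrisFun (move i))
      (fun i x y h => tetris_lt (move i) (hwf i) (hfin i) h))
    (comb_fin 𝓗 move hfin)
  have hn := le_tetris_iff (nimMove 𝓗)
    (comb_wf (X := fun _ => ℕ) 𝓗 hne (fun _ a b => b < a) (fun _ a => a)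
      (fun _ _ _ h => h))
    (comb_fin (X := fun _ => ℕ) 𝓗 (fun _ a b => b < a) (fun _ a => Set.finite_Iio a))
  have fwd : ∀ (n : ℕ) (x : ∀ i, X i), HasPlay (combMove 𝓗 move) n x →
      HasPlay (nimMove 𝓗) n (fun i => tetrisFun (move i) (x i)) := by
    intro n
    induction n with
    | zero => intro x _; trivial
    | succ n ih =>
      rintro x ⟨y, ⟨H, hH, h1, h2⟩, hp⟩
      refine ⟨_, ⟨H, hH, fun i hi => ?_, fun i hi => ?_⟩, ih y hp⟩
      · exact tetris_lt (move i) (hwf i) (hfin i) (h1 i hi)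
      · simp only [h2 i hi]
  have bwd : ∀ (n : ℕ) (x : ∀ i, X i) (a : V → ℕ), (∀ i, a i ≤ tetrisFun (move i) (x i)) →
      HasPlay (nimMove 𝓗) n a → HasPlay (combMove 𝓗 move) n x := by
    intro n
    induction n with
    | zero => intro x _ _ _; trivial
    | succ n ih =>
      rintro x a ha ⟨b, ⟨H, hH, h1, h2⟩, hp⟩
      have key : ∀ i, ∃ y, (i ∈ H → move i (x i) y) ∧ (i ∉ H → y = x i) ∧
          b i ≤ tetrisFun (move i) y := by
        intro i
        by_cases hi : i ∈ H
        · obtain ⟨y, hy, hb⟩ := tetris_exists (move i) (hwf i) (hfin i)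
            (lt_of_lt_of_le (h1 i hi) (ha i))
          exact ⟨y, fun _ => hy, fun h => absurd hi h, hb⟩
        · exact ⟨x i, fun h => absurd h hi, fun _ => rfl, by rw [h2 i hi]; exact ha i⟩
      choose y hy1 hy2 hy3 using key
      exact ⟨y, ⟨H, hH, hy1, hy2⟩, ih y b hy3 hp⟩
  intro x
  apply le_antisymm
  · exact (hn _ _).2 (fwd _ x ((hc _ x).1 le_rfl))
  · exact (hc _ x).2 (bwd _ x _ (fun _ => le_rfl) ((hn _ _).1 le_rfl))
end

section
/- Let V = ℤ/9ℤ and let 𝓗 be the hypergraph on V with hyperedges T_i = {i, i+1, i+2} and F_i = {i, i+1, i+4, i+6} for all i ∈ ℤ/9ℤ (indices modulo 9). Then 𝓗 satisfies condition (*), but 𝓖_𝓗 ≠ 𝓣_𝓗; in particular 𝓗 is not a Tetris hypergraph. (Concretely, for the all-ones position x one has 𝓣_𝓗(x) = 3 but no move x → x' achieves 𝓣_𝓗(x') = 1.) -/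
/-- The hypergraph on `ℤ/9ℤ` with hyperedges `T i = {i, i+1, i+2}` and
`F i = {i, i+1, i+4, i+6}` for all `i`. -/
def H9 : Set (Finset (ZMod 9)) :=
  {H | (∃ i : ZMod 9, H = {i, i + 1, i + 2}) ∨
       (∃ i : ZMod 9, H = {i, i + 1, i + 4, i + 6})}

def TT (i : ZMod 9) : Finset (ZMod 9) := {i, i + 1, i + 2}
def FF (i : ZMod 9) : Finset (ZMod 9) := {i, i + 1, i + 4, i + 6}

theorem TT_mem (i : ZMod 9) : TT i ∈ H9 := Or.inl ⟨i, rfl⟩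
theorem FF_mem (i : ZMod 9) : FF i ∈ H9 := Or.inr ⟨i, rfl⟩

theorem H9_cases {H : Finset (ZMod 9)} (h : H ∈ H9) : (∃ i, H = TT i) ∨ ∃ i, H = FF i := h

theorem F_meets_T : ∀ i j, (FF i ∩ TT j).Nonempty := by decide +kernel
theorem F_meets_F : ∀ i j, (FF i ∩ FF j).Nonempty := by decide +kernel
theorem T_card : ∀ i, 3 ≤ (TT i).card := by decide +kernel
theorem F_card : ∀ i, 3 ≤ (FF i).card := by decide +kernel

theorem F_meets (i : ZMod 9) {H : Finset (ZMod 9)} (h : H ∈ H9) : (FF i ∩ H).Nonempty := by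
  rcases H9_cases h with ⟨j, rfl⟩ | ⟨j, rfl⟩
  · exact F_meets_T i j
  · exact F_meets_F i j

theorem H_card {H : Finset (ZMod 9)} (h : H ∈ H9) : 3 ≤ H.card := by
  rcases H9_cases h with ⟨j, rfl⟩ | ⟨j, rfl⟩
  · exact T_card j
  · exact F_card j

theorem star_aux_bool : ∀ b0 b1 b2 b3 b4 b5 b6 b7 b8 : Bool,
    let p : Fin 9 → Bool := ![b0, b1, b2, b3, b4, b5, b6, b7, b8]
    (∃ i, p i && p (i + 1) && p (i + 4) && p (i + 6)) ∨
    (∀ i, ¬ (p i && p (i + 1) && p (i + 2))) ∨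
    ∃ i, (p i && p (i + 1) && p (i + 2)) ∧ ∀ j, (p j && p (j + 1) && p (j + 2)) →
      (j = i ∨ j = i + 1 ∨ j = i + 2 ∨ i = j + 1 ∨ i = j + 2) := by
  decide +kernel

theorem star_aux (p : ZMod 9 → Bool) :
    (∃ i, p i && p (i + 1) && p (i + 4) && p (i + 6)) ∨
    (∀ i, ¬ (p i && p (i + 1) && p (i + 2))) ∨
    ∃ i, (p i && p (i + 1) && p (i + 2)) ∧ ∀ j, (p j && p (j + 1) && p (j + 2)) →
      (j = i ∨ j = i + 1 ∨ j = i + 2 ∨ i = j + 1 ∨ i = j + 2) := by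
  have h := star_aux_bool (p 0) (p 1) (p 2) (p 3) (p 4) (p 5) (p 6) (p 7) (p 8)
  have e : (![p 0, p 1, p 2, p 3, p 4, p 5, p 6, p 7, p 8] : Fin 9 → Bool) = p := by
    funext i
    fin_cases i <;> rfl
  simp only [e] at h
  exact h

theorem T_meets : ∀ i j : ZMod 9,
    (j = i ∨ j = i + 1 ∨ j = i + 2 ∨ i = j + 1 ∨ i = j + 2) → (TT i ∩ TT j).Nonempty := by
  decide +kernel

theorem H9_star : CondStar H9 := by
  rintro S ⟨H, hH, hS⟩
  have TS : ∀ i, TT i ⊆ S ↔ (decide (i ∈ S) && decide (i + 1 ∈ S) && decide (i + 2 ∈ S)) := by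
    intro i; simp [TT, Finset.insert_subset_iff, and_assoc]
  have FS : ∀ i, FF i ⊆ S ↔ (decide (i ∈ S) && decide (i + 1 ∈ S) && decide (i + 4 ∈ S)
      && decide (i + 6 ∈ S)) := by
    intro i; simp [FF, Finset.insert_subset_iff, and_assoc]
  have h := star_aux (fun i => decide (i ∈ S))
  simp only [← TS, ← FS] at h
  by_cases hF : ∃ i, FF i ⊆ S
  · obtain ⟨i, hi⟩ := hF
    exact ⟨FF i, FF_mem i, hi, fun H' h' _ => F_meets i h'⟩
  rcases h with h | h | ⟨i, hi, h⟩
  · exact absurd h hF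
  · rcases H9_cases hH with ⟨j, rfl⟩ | ⟨j, rfl⟩
    · exact absurd hS (h j)
    · exact absurd ⟨j, hS⟩ hF
  · refine ⟨TT i, TT_mem i, hi, fun H' h' hs => ?_⟩
    rcases H9_cases h' with ⟨j, rfl⟩ | ⟨j, rfl⟩
    · exact T_meets i j (h j hs)
    · exact absurd ⟨j, hs⟩ hF

theorem move_sum {x y : ZMod 9 → ℕ} (h : nimMove H9 x y) : ∑ i, y i + 3 ≤ ∑ i, x i := by
  obtain ⟨H, hH, h1, h2⟩ := h
  have h3 : ∑ i, (y i + if i ∈ H then 1 else 0) ≤ ∑ i, x i := by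
    apply Finset.sum_le_sum
    intro i _
    by_cases hi : i ∈ H
    · simpa [hi] using h1 i hi
    · simp [hi, h2 i hi]
  rw [Finset.sum_add_distrib] at h3
  have := H_card hH
  simp at h3
  omega

theorem wf9 : WellFounded (fun y x => nimMove H9 x y) := by
  refine Subrelation.wf (r := InvImage (· < ·) (fun x : ZMod 9 → ℕ => ∑ i, x i)) ?_
    (InvImage.wf _ wellFounded_lt)
  intro y x h
  have := move_sum h
  simp only [InvImage]
  omega

theorem sg_eq (x : ZMod 9 → ℕ) : sgFun (nimMove H9) x =
    mex {v : ℕ | ∃ (y : ZMod 9 → ℕ) (_ : nimMove H9 x y), sgFun (nimMove H9) y = v} := by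
  unfold sgFun
  simp only [dif_pos wf9]
  rw [WellFounded.fix_eq]

theorem tetris_eq (x : ZMod 9 → ℕ) : tetrisFun (nimMove H9) x =
    sSup {v : ℕ | ∃ (y : ZMod 9 → ℕ) (_ : nimMove H9 x y),
      v = tetrisFun (nimMove H9) y + 1} := by
  unfold tetrisFun
  simp only [dif_pos wf9]
  rw [WellFounded.fix_eq]

theorem tetris_bound (x : ZMod 9 → ℕ) : 3 * tetrisFun (nimMove H9) x ≤ ∑ i, x i := by
  induction x using wf9.induction with
  | _ x ih =>
  have : tetrisFun (nimMove H9) x ≤ (∑ i, x i) / 3 := by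
    rw [tetris_eq]
    apply csSup_le'
    rintro v ⟨y, h, rfl⟩
    have := ih y h
    have := move_sum h
    omega
  omega

theorem tetris_lt_s8 {x y : ZMod 9 → ℕ} (h : nimMove H9 x y) :
    tetrisFun (nimMove H9) y < tetrisFun (nimMove H9) x := by
  rw [tetris_eq x]
  refine le_csSup ⟨∑ i, x i, ?_⟩ ⟨y, h, rfl⟩
  rintro v ⟨z, hz, rfl⟩
  have := tetris_bound z
  have := move_sum hz
  omega

def ind (S : Finset (ZMod 9)) : ZMod 9 → ℕ := fun i => if i ∈ S then 1 else 0

theorem ind_move {S H : Finset (ZMod 9)} (hH : H ∈ H9) (h : H ⊆ S) :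
    nimMove H9 (ind S) (ind (S \ H)) := by
  refine ⟨H, hH, fun i hi => ?_, fun i hi => ?_⟩
  · simp [ind, hi, h hi]
  · simp [ind, hi]

theorem ones_eq : (fun _ => 1 : ZMod 9 → ℕ) = ind Finset.univ := by
  funext i; simp [ind]

theorem ones_move {y : ZMod 9 → ℕ} (h : nimMove H9 (fun _ => 1) y) :
    (∃ i, y = ind (Finset.univ \ TT i)) ∨ ∃ i, y = ind (Finset.univ \ FF i) := by
  obtain ⟨H, hH, h1, h2⟩ := h
  have : y = ind (Finset.univ \ H) := by
    funext i
    by_cases hi : i ∈ H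
    · have : y i < 1 := h1 i hi
      simp [ind, hi]; omega
    · simp [ind, hi, h2 i hi]
  rcases H9_cases hH with ⟨j, rfl⟩ | ⟨j, rfl⟩
  · exact Or.inl ⟨j, this⟩
  · exact Or.inr ⟨j, this⟩

theorem F_terminal (i : ZMod 9) (y : ZMod 9 → ℕ) :
    ¬ nimMove H9 (ind (Finset.univ \ FF i)) y := by
  rintro ⟨H, hH, h1, -⟩
  obtain ⟨j, hj⟩ := F_meets i hH
  rw [Finset.mem_inter] at hj
  have := h1 j hj.2
  simp [ind, hj.1] at this

theorem T_sub1 : ∀ i, TT (i + 3) ⊆ Finset.univ \ TT i := by decide +kernel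
theorem T_sub2 : ∀ i, TT (i + 6) ⊆ (Finset.univ \ TT i) \ TT (i + 3) := by decide +kernel

theorem T_two (f : (ZMod 9 → ℕ) → ℕ) (hf : ∀ x y, nimMove H9 x y → f y < f x) (i : ZMod 9) :
    2 ≤ f (ind (Finset.univ \ TT i)) := by
  have h1 := hf _ _ (ind_move (TT_mem (i + 3)) (T_sub1 i))
  have h2 := hf _ _ (ind_move (TT_mem (i + 6)) (T_sub2 i))
  omega

theorem ones_three (f : (ZMod 9 → ℕ) → ℕ) (hf : ∀ x y, nimMove H9 x y → f y < f x) :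
    3 ≤ f (fun _ => 1) := by
  have h1 := hf _ _ (ind_move (TT_mem 0) (Finset.subset_univ _))
  have h2 := T_two f hf 0
  rw [ones_eq]
  omega

theorem mex_le {S : Set ℕ} {n : ℕ} (h : n ∉ S) : mex S ≤ n := Nat.sInf_le h

theorem not_tetris : ¬ IsTetrisHypergraph H9 := by
  intro hd
  have h3 := ones_three _ hd
  have h1 : sgFun (nimMove H9) (fun _ => 1) ≤ 1 := by
    rw [sg_eq]
    apply mex_le
    rintro ⟨y, hy, h⟩
    rcases ones_move hy with ⟨i, rfl⟩ | ⟨i, rfl⟩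
    · have := T_two _ hd i
      omega
    · rw [sg_eq] at h
      have : (0 : ℕ) ∉ {v : ℕ | ∃ (y : ZMod 9 → ℕ)
          (_ : nimMove H9 (ind (Finset.univ \ FF i)) y), sgFun (nimMove H9) y = v} := by
        rintro ⟨z, hz, -⟩
        exact F_terminal i z hz
      have := mex_le this
      omega
  omega

theorem stmt8 :
    CondStar H9 ∧
    sgFun (nimMove H9) ≠ tetrisFun (nimMove H9) ∧
    ¬ IsTetrisHypergraph H9 ∧
    tetrisFun (nimMove H9) (fun _ => 1) = 3 ∧
    ¬ ∃ x' : ZMod 9 → ℕ, nimMove H9 (fun _ => 1) x' ∧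
      tetrisFun (nimMove H9) x' = 1 := by
  refine ⟨H9_star, fun h => not_tetris ?_, not_tetris, ?_, ?_⟩
  · intro x y hxy
    rw [h]
    exact tetris_lt_s8 hxy
  · have h1 := ones_three _ (fun x y h => tetris_lt_s8 h)
    have h2 := tetris_bound (fun _ => 1)
    simp [ZMod.card] at h2
    omega
  · rintro ⟨y, hy, h⟩
    rcases ones_move hy with ⟨i, rfl⟩ | ⟨i, rfl⟩
    · have := T_two _ (fun x y h => tetris_lt_s8 h) i
      omega
    · have : tetrisFun (nimMove H9) (ind (Finset.univ \ FF i)) ≤ 0 := by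
        rw [tetris_eq]
        apply csSup_le'
        rintro v ⟨z, hz, -⟩
        exact absurd hz (F_terminal i z)
      omega
end
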